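/- Let d ≥ 1 be an integer, σ ∈ (0, π/2), ρ₊ > 0, ρ₋ > 0, s ∈ ℝ, and n ∈ ℕ. Then there exists a constant C = C(d, s, n, σ, ρ₊, ρ₋) > 0 such that for every complex λ with λ ≠ 0 and |arg λ| < π − σ, and every x ∈ ℝ^d with x ≠ 0, one has ‖D^n(y ↦ (ρ₊ A₋(y) + ρ₋ A₊(y))^s)(x)‖ ≤ C · (|λ|^{1/2} + ‖x‖)^{s − n}, where A_±(y) = √(ρ_± λ + ‖y‖²) ∈ ℂ (principal square roots) and the power is the principal complex power. -/

import Mathlib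

open Real

open Complex in
lemma ofReal_mul_cpow {t : ℝ} (ht : 0 < t) (z c : ℂ) :
    ((t : ℂ) * z) ^ c = (t : ℂ) ^ c * z ^ c := by
  have ht' : (t : ℂ) ≠ 0 := by exact_mod_cast ht.ne'
  rcases eq_or_ne z 0 with rfl | hz
  · rcases eq_or_ne c 0 with rfl | hc
    · simp
    · simp [zero_cpow hc]
  · rw [cpow_def_of_ne_zero (mul_ne_zero ht' hz), cpow_def_of_ne_zero ht',
      cpow_def_of_ne_zero hz, log_ofReal_mul ht hz, add_mul, Complex.exp_add, ofReal_log ht.le]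

lemma sq_mul_cpow_one_half {t : ℝ} (ht : 0 < t) (z : ℂ) :
    ((t : ℂ) ^ 2 * z) ^ ((1 : ℂ) / 2) = (t : ℂ) * z ^ ((1 : ℂ) / 2) := by
  have h := ofReal_mul_cpow (pow_pos ht 2) z (1 / 2)
  push_cast at h
  rw [h]
  congr 1
  have h2 : ((1 : ℂ) / 2) = ((1 / 2 : ℝ) : ℂ) := by push_cast; ring
  rw [h2, ← Complex.ofReal_pow, ← Complex.ofReal_cpow (by positivity), ← Real.sqrt_eq_rpow,
    Real.sqrt_sq ht.le]

open Complex in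
lemma re_cpow_one_half_pos {z : ℂ} (hz : z ∈ slitPlane) : 0 < (z ^ ((1 : ℂ) / 2)).re := by
  have h2 : ((1 : ℂ) / 2) = ((1 / 2 : ℝ) : ℂ) := by push_cast; ring
  rw [h2, cpow_ofReal_re]
  have h0 : 0 < ‖z‖ := norm_pos_iff.2 (slitPlane_ne_zero hz)
  have h1 := (mem_slitPlane_iff_arg.1 hz).1
  have h3 := neg_pi_lt_arg z
  have h4 := lt_of_le_of_ne (arg_le_pi z) h1
  exact mul_pos (Real.rpow_pos_of_pos h0 _)
    (Real.cos_pos_of_mem_Ioo ⟨by linarith, by linarith⟩)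

lemma ContDiffAt.cpow_const_of_mem_slitPlane {V : Type*} [NormedAddCommGroup V] [NormedSpace ℝ V]
    {f : V → ℂ} {x : V} {n : ℕ} (hf : ContDiffAt ℝ n f x) (hx : f x ∈ Complex.slitPlane) (c : ℂ) :
    ContDiffAt ℝ n (fun y => f y ^ c) x := by
  have h : AnalyticAt ℂ (fun z : ℂ => z ^ c) (f x) := analyticAt_id.cpow analyticAt_const hx
  exact (h.contDiffAt.restrict_scalars ℝ).comp x hf

lemma norm_iteratedFDeriv_comp_add_clm_le {E V F : Type*} [NormedAddCommGroup E] [NormedSpace ℝ E]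
    [NormedAddCommGroup V] [NormedSpace ℝ V] [NormedAddCommGroup F] [NormedSpace ℝ F]
    {f : V → F} {U : Set V} {n : ℕ} (hU : IsOpen U) (hf : ContDiffOn ℝ n f U) (v : V)
    (L : E →L[ℝ] V) {x : E} (hx : v + L x ∈ U) :
    ‖iteratedFDeriv ℝ n (fun y => f (v + L y)) x‖ ≤
      ‖iteratedFDeriv ℝ n f (v + L x)‖ * ‖L‖ ^ n := by
  have hW : IsOpen ((v + ·) ⁻¹' U) := hU.preimage (by fun_prop)
  have hg : ContDiffOn ℝ n (fun z => f (v + z)) ((v + ·) ⁻¹' U) :=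
    hf.comp (by fun_prop) fun _ h => h
  have hLW : IsOpen (L ⁻¹' ((v + ·) ⁻¹' U)) := hW.preimage L.continuous
  have h := L.iteratedFDerivWithin_comp_right hg hW.uniqueDiffOn hLW.uniqueDiffOn hx le_rfl
  rw [iteratedFDerivWithin_of_isOpen n hLW hx, iteratedFDerivWithin_of_isOpen n hW hx,
    iteratedFDeriv_comp_add_left] at h
  change ‖iteratedFDeriv ℝ n ((fun z => f (v + z)) ∘ L) x‖ ≤ _
  rw [h]
  simpa using ContinuousMultilinearMap.norm_compContinuousLinearMap_le
    (iteratedFDeriv ℝ n f (v + L x)) fun _ => L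

section Symbol

variable {E : Type*} [NormedAddCommGroup E] [InnerProductSpace ℝ E]

/-- The radicand `ρλ + ‖y‖²` as a function of `(λ, y)`. -/
noncomputable def radicand (ρ : ℝ) (p : ℂ × E) : ℂ := (ρ : ℂ) * p.1 + (‖p.2‖ : ℂ) ^ 2

/-- The symbol `(ρ₊A₋(y) + ρ₋A₊(y))^s` as a function of `(λ, y)`. -/
noncomputable def symbol (ρp ρm s : ℝ) (p : ℂ × E) : ℂ :=
  ((ρp : ℂ) * radicand ρm p ^ ((1 : ℂ) / 2) + (ρm : ℂ) * radicand ρp p ^ ((1 : ℂ) / 2)) ^ (s : ℂ)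

/-- The pairs `(λ, y)` at which both radicands avoid the branch cut. -/
def symbolDomain (ρp ρm : ℝ) : Set (ℂ × E) :=
  {p | radicand ρm p ∈ Complex.slitPlane ∧ radicand ρp p ∈ Complex.slitPlane}

lemma contDiff_radicand (ρ : ℝ) {n : ℕ} : ContDiff ℝ n (radicand (E := E) ρ) := by
  have h : ContDiff ℝ n fun p : ℂ × E => ((‖p.2‖ ^ 2 : ℝ) : ℂ) :=
    Complex.ofRealCLM.contDiff.comp (contDiff_snd.norm_sq ℝ)
  unfold radicand
  simp only [← Complex.ofReal_pow]
  exact (contDiff_const.mul contDiff_fst).add h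

lemma isOpen_symbolDomain (ρp ρm : ℝ) : IsOpen (symbolDomain (E := E) ρp ρm) :=
  (Complex.isOpen_slitPlane.preimage (contDiff_radicand ρm (n := 0)).continuous).inter
    (Complex.isOpen_slitPlane.preimage (contDiff_radicand ρp (n := 0)).continuous)

lemma contDiffOn_symbol {ρp ρm : ℝ} (hρp : 0 < ρp) (hρm : 0 < ρm) (s : ℝ) (n : ℕ) :
    ContDiffOn ℝ n (symbol (E := E) ρp ρm s) (symbolDomain ρp ρm) := by
  rintro p ⟨hm, hp⟩
  refine ContDiffAt.contDiffWithinAt (ContDiffAt.cpow_const_of_mem_slitPlane ?_ (Or.inl ?_) _)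
  · exact (contDiffAt_const.mul
      ((contDiff_radicand ρm).contDiffAt.cpow_const_of_mem_slitPlane hm _)).add
      (contDiffAt_const.mul ((contDiff_radicand ρp).contDiffAt.cpow_const_of_mem_slitPlane hp _))
  · rw [Complex.add_re, Complex.re_ofReal_mul, Complex.re_ofReal_mul]
    exact add_pos (mul_pos hρp (re_cpow_one_half_pos hm)) (mul_pos hρm (re_cpow_one_half_pos hp))

lemma radicand_smul {t : ℝ} (ht : 0 < t) (ρ : ℝ) (μ : ℂ) (y : E) :
    radicand ρ ((t : ℂ) ^ 2 * μ, t • y) = (t : ℂ) ^ 2 * radicand ρ (μ, y) := by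
  simp only [radicand, norm_smul, Real.norm_of_nonneg ht.le]
  push_cast
  ring

lemma symbol_smul {t : ℝ} (ht : 0 < t) (ρp ρm s : ℝ) (μ : ℂ) (y : E) :
    symbol ρp ρm s ((t : ℂ) ^ 2 * μ, t • y) = t ^ s • symbol ρp ρm s (μ, y) := by
  simp only [symbol, radicand_smul ht, sq_mul_cpow_one_half ht]
  rw [mul_left_comm, mul_left_comm (ρm : ℂ), ← mul_add, ofReal_mul_cpow ht,
    ← Complex.ofReal_cpow ht.le, Complex.real_smul]

/-- The part of the closed sector `{|arg λ| ≤ π - σ} × E` with `|λ|^{1/2} + ‖y‖ = 1`. -/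
def sectorSphere (E : Type*) [NormedAddCommGroup E] (σ : ℝ) : Set (ℂ × E) :=
  {p | -Real.cos σ * ‖p.1‖ ≤ p.1.re ∧ ‖p.1‖ ^ ((1 : ℝ) / 2) + ‖p.2‖ = 1}

lemma isCompact_sectorSphere [FiniteDimensional ℝ E] (σ : ℝ) :
    IsCompact (sectorSphere E σ) := by
  have : ProperSpace E := FiniteDimensional.proper ℝ E
  have hc : Continuous fun p : ℂ × E => ‖p.1‖ ^ ((1 : ℝ) / 2) :=
    continuous_fst.norm.rpow_const fun _ => Or.inr (by norm_num)
  refine (isCompact_closedBall (0 : ℂ × E) 1).of_isClosed_subset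
    ((isClosed_le (by fun_prop) (Complex.continuous_re.comp continuous_fst)).inter
      (isClosed_eq (hc.add continuous_snd.norm) continuous_const)) ?_
  rintro ⟨μ, y⟩ ⟨-, h⟩
  have h1 : ‖μ‖ ^ ((1 : ℝ) / 2) ≤ 1 := by linarith [norm_nonneg y]
  have h2 : ‖y‖ ≤ 1 := by linarith [Real.rpow_nonneg (norm_nonneg μ) (1 / 2)]
  rw [← Real.sqrt_eq_rpow, Real.sqrt_le_one] at h1
  simpa [Prod.norm_def] using And.intro h1 h2

lemma radicand_mem_slitPlane {V : Type*} [NormedAddCommGroup V] {σ ρ : ℝ}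
    (hσ : σ ∈ Set.Ioo 0 (π / 2)) (hρ : 0 < ρ) {p : ℂ × V} (hp : p ∈ sectorSphere V σ) :
    radicand ρ p ∈ Complex.slitPlane := by
  obtain ⟨μ, y⟩ := p
  obtain ⟨h1, h2⟩ := hp
  dsimp only at h1 h2
  have hcos : Real.cos σ < 1 := by
    have := Real.cos_lt_cos_of_nonneg_of_le_pi_div_two le_rfl hσ.2.le hσ.1
    simpa using this
  by_contra h
  have hre : (radicand ρ (μ, y)).re = ρ * μ.re + ‖y‖ ^ 2 := by
    simp [radicand, ← Complex.ofReal_pow]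
  have him : (radicand ρ (μ, y)).im = ρ * μ.im := by
    simp [radicand, ← Complex.ofReal_pow]
  rw [Complex.mem_slitPlane_iff, hre, him] at h
  push Not at h
  obtain ⟨h3, h4⟩ := h
  have him0 : μ.im = 0 := (mul_eq_zero.1 h4).resolve_left hρ.ne'
  have hnorm : ‖μ‖ = |μ.re| := (Complex.abs_re_eq_norm.2 him0).symm
  have hre0 : μ.re ≤ 0 := by
    by_contra! h
    nlinarith [mul_pos hρ h, sq_nonneg ‖y‖]
  rw [hnorm, abs_of_nonpos hre0] at h1
  have hre1 : μ.re = 0 := by nlinarith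
  have hμ : μ = 0 := Complex.ext hre1 him0
  have hy : ‖y‖ = 0 := by
    rw [hre1, mul_zero, zero_add] at h3
    exact pow_eq_zero_iff two_ne_zero |>.1 (le_antisymm h3 (sq_nonneg _))
  rw [hμ, hy, norm_zero, Real.zero_rpow (by norm_num)] at h2
  norm_num at h2

lemma neg_cos_mul_norm_le_re {σ : ℝ} (hσ : 0 ≤ σ) {lam : ℂ} (h : |lam.arg| ≤ π - σ) :
    -Real.cos σ * ‖lam‖ ≤ lam.re := by
  have h1 := Real.cos_le_cos_of_nonneg_of_le_pi (abs_nonneg _) (by linarith) h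
  rw [Real.cos_pi_sub, Real.cos_abs] at h1
  rw [← Complex.norm_mul_cos_arg lam, mul_comm]
  exact mul_le_mul_of_nonneg_left h1 (norm_nonneg _)

lemma mem_sectorSphere_of_smul {σ t : ℝ} {μ : ℂ} {y : E} (ht : 0 < t)
    (h : -Real.cos σ * ‖(t : ℂ) ^ 2 * μ‖ ≤ ((t : ℂ) ^ 2 * μ).re)
    (hn : ‖(t : ℂ) ^ 2 * μ‖ ^ ((1 : ℝ) / 2) + ‖t • y‖ = t) : (μ, y) ∈ sectorSphere E σ := by
  have h1 : ‖(t : ℂ) ^ 2 * μ‖ = t ^ 2 * ‖μ‖ := by simp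
  have h2 : ((t : ℂ) ^ 2 * μ).re = t ^ 2 * μ.re := by
    rw [← Complex.ofReal_pow, Complex.re_ofReal_mul]
  rw [h1, h2] at h
  rw [h1, norm_smul, Real.norm_of_nonneg ht.le, ← Real.sqrt_eq_rpow,
    Real.sqrt_mul (by positivity), Real.sqrt_sq ht.le, ← mul_add] at hn
  refine ⟨?_, ?_⟩
  · exact le_of_mul_le_mul_left (by linarith) (pow_pos ht 2)
  · rw [← Real.sqrt_eq_rpow]
    exact (mul_eq_left₀ ht.ne').1 hn

lemma norm_iteratedFDeriv_symbol_le {ρp ρm : ℝ} (hρp : 0 < ρp) (hρm : 0 < ρm) (s : ℝ) (n : ℕ)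
    {t : ℝ} (ht : 0 < t) {μ : ℂ} {w : E} (hw : (μ, w) ∈ symbolDomain ρp ρm) :
    ‖iteratedFDeriv ℝ n (fun y : E => symbol ρp ρm s ((t : ℂ) ^ 2 * μ, y)) (t • w)‖ ≤
      ‖iteratedFDeriv ℝ n (symbol (E := E) ρp ρm s) (μ, w)‖ * t ^ (s - n) := by
  set L : E →L[ℝ] ℂ × E := t⁻¹ • ContinuousLinearMap.inr ℝ ℂ E with hL
  have hLnorm : ‖L‖ ≤ t⁻¹ := by
    refine L.opNorm_le_bound (by positivity) fun y => ?_
    simp [hL, Prod.norm_def, norm_smul, abs_of_pos ht]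
    positivity
  have hLapp (y : E) : (μ, (0 : E)) + L y = (μ, t⁻¹ • y) := by simp [hL]
  have hfun : (fun y : E => symbol ρp ρm s ((t : ℂ) ^ 2 * μ, y)) =
      fun y => t ^ s • symbol ρp ρm s ((μ, (0 : E)) + L y) := by
    ext y
    rw [hLapp, ← symbol_smul ht, smul_inv_smul₀ ht.ne']
  have hLw : (μ, (0 : E)) + L (t • w) = (μ, w) := by rw [hLapp, inv_smul_smul₀ ht.ne']
  have hf := contDiffOn_symbol (E := E) hρp hρm s n
  have hU := isOpen_symbolDomain (E := E) ρp ρm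
  have hbound := norm_iteratedFDeriv_comp_add_clm_le hU hf (μ, 0) L (x := t • w) (by rwa [hLw])
  rw [hLw] at hbound
  have hsm : ContDiffAt ℝ n (fun y => symbol ρp ρm s ((μ, (0 : E)) + L y)) (t • w) := by
    refine ContDiffAt.comp (t • w) (g := symbol ρp ρm s) ?_ (by fun_prop)
    rw [hLw]
    exact hf.contDiffAt (hU.mem_nhds hw)
  rw [hfun, iteratedFDeriv_const_smul_apply' hsm, norm_smul,
    Real.norm_of_nonneg (Real.rpow_nonneg ht.le _), Real.rpow_sub ht, Real.rpow_natCast]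
  calc t ^ s * _ ≤ t ^ s * (‖iteratedFDeriv ℝ n (symbol (E := E) ρp ρm s) (μ, w)‖ * t⁻¹ ^ n) := by
        gcongr
        exact hbound.trans (by gcongr)
    _ = _ := by rw [inv_pow]; ring

end Symbol

/-- Lemma 2.2(1), second estimate: derivative bounds for `y ↦ (ρ₊A₋(y) + ρ₋A₊(y))^s`,
where `A_±(y) = √(ρ_± λ + ‖y‖²)` are principal complex square roots. -/
theorem stmt_2 (d : ℕ) (hd : 1 ≤ d) (σ : ℝ) (hσ : σ ∈ Set.Ioo 0 (π / 2))
    (ρp ρm : ℝ) (hρp : 0 < ρp) (hρm : 0 < ρm) (s : ℝ) (n : ℕ) :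
    ∃ C : ℝ, 0 < C ∧ ∀ lam : ℂ, lam ≠ 0 → |lam.arg| < π - σ →
      ∀ x : EuclideanSpace ℝ (Fin d), x ≠ 0 →
        ‖iteratedFDeriv ℝ n
            (fun y : EuclideanSpace ℝ (Fin d) =>
              ((ρp : ℂ) * (((ρm : ℂ) * lam + (‖y‖ : ℂ) ^ 2) ^ ((1 : ℂ) / 2)) +
                (ρm : ℂ) * (((ρp : ℂ) * lam + (‖y‖ : ℂ) ^ 2) ^ ((1 : ℂ) / 2))) ^ (s : ℂ)) x‖ ≤
          C * (‖lam‖ ^ ((1 : ℝ) / 2) + ‖x‖) ^ (s - n) := by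
  set E := EuclideanSpace ℝ (Fin d)
  have hU := isOpen_symbolDomain (E := E) ρp ρm
  have hKU : sectorSphere E σ ⊆ symbolDomain ρp ρm := fun p hp =>
    ⟨radicand_mem_slitPlane hσ hρm hp, radicand_mem_slitPlane hσ hρp hp⟩
  have hcont : ContinuousOn (iteratedFDeriv ℝ n (symbol (E := E) ρp ρm s)) (sectorSphere E σ) :=
    (((contDiffOn_symbol hρp hρm s n).continuousOn_iteratedFDerivWithin le_rfl
      hU.uniqueDiffOn).congr fun p hp => (iteratedFDerivWithin_of_isOpen n hU hp).symm).mono hKU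
  obtain ⟨C, hC⟩ := (isCompact_sectorSphere (E := E) σ).exists_bound_of_continuousOn hcont
  refine ⟨max C 1, by positivity, fun lam _ harg x hx => ?_⟩
  have ht : 0 < ‖lam‖ ^ ((1 : ℝ) / 2) + ‖x‖ :=
    add_pos_of_nonneg_of_pos (by positivity) (norm_pos_iff.2 hx)
  obtain ⟨t, ht_def⟩ : ∃ t, ‖lam‖ ^ ((1 : ℝ) / 2) + ‖x‖ = t := ⟨_, rfl⟩
  rw [ht_def] at ht ⊢
  have ht' : (t : ℂ) ^ 2 ≠ 0 := by exact_mod_cast (pow_pos ht 2).ne'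
  obtain ⟨μ, rfl⟩ : ∃ μ, lam = (t : ℂ) ^ 2 * μ := ⟨lam / (t : ℂ) ^ 2, (mul_div_cancel₀ lam ht').symm⟩
  obtain ⟨w, rfl⟩ : ∃ w, x = t • w := ⟨t⁻¹ • x, (smul_inv_smul₀ ht.ne' x).symm⟩
  have hK : (μ, w) ∈ sectorSphere E σ :=
    mem_sectorSphere_of_smul ht (neg_cos_mul_norm_le_re hσ.1.le harg.le) ht_def
  refine (norm_iteratedFDeriv_symbol_le hρp hρm s n ht (hKU hK)).trans ?_
  gcongr
  exact (hC _ hK).trans (le_max_left _ _)
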